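/- For the complete tripartite 2-complex K²_{m,m,m}, the independence number equals 2m and ϑ_2(K²_{m,m,m}) = 2m. -/

import Mathlib

open Finset Matrix

/-- The oriented incidence number `[F:K]` induced by the global linear order on
the vertices: it is `(-1)^j` if `K ⊆ F`, `F ∖ K = {x_j}` and `x_j` is the `j`-th
smallest element of `F`, and `0` otherwise. -/
def inc {V : Type} [DecidableEq V] [LinearOrder V] (F K : Finset V) : ℝ :=
  if K ⊆ F ∧ F.card = K.card + 1 then
    ∑ x ∈ F \ K, (-1 : ℝ) ^ (K.filter (fun y => y < x)).card
  else 0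

/-- An abstract simplicial complex on a vertex type `V`: a family of finite subsets
of `V` closed under taking subsets. -/
structure SC (V : Type) [DecidableEq V] where
  faces : Finset (Finset V)
  down_closed : ∀ ⦃F⦄, F ∈ faces → ∀ ⦃K : Finset V⦄, K ⊆ F → K ∈ faces

variable {V : Type} [Fintype V] [DecidableEq V] [LinearOrder V]

/-- The faces of cardinality `m` (i.e. of dimension `m-1`) of a complex. -/
def SC.dfaces (X : SC V) (m : ℕ) : Finset (Finset V) := X.faces.filter fun F => F.card = m

/-- The faces of cardinality `m`, as a type (index set of the space `C^{m-1}` of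
`(m-1)`-dimensional cochains). -/
abbrev Face (X : SC V) (m : ℕ) := {F : Finset V // F ∈ X.dfaces m}

/-- The matrix of the coboundary map `δ_{m-1}` from `(m-1)`-dimensional cochains
(functions on cardinality-`m` faces) to `m`-dimensional cochains, in the bases of
elementary cochains. -/
def deltaMat (X : SC V) (m : ℕ) : Matrix (Face X (m + 1)) (Face X m) ℝ :=
  fun H F => inc H.1 F.1

/-- The up-Laplacian `L↑_{m-1} = ∂_m δ_{m-1}` acting on `(m-1)`-dimensional cochains,
where `∂ = δ*` is the adjoint (transpose) of the coboundary map. -/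
def Lup (X : SC V) (m : ℕ) : Matrix (Face X m) (Face X m) ℝ :=
  (deltaMat X m)ᵀ * deltaMat X m

/-- The down-Laplacian `L↓_m = δ_{m-1} ∂_m` acting on `m`-dimensional cochains. -/
def Ldown (X : SC V) (m : ℕ) : Matrix (Face X (m + 1)) (Face X (m + 1)) ℝ :=
  deltaMat X m * (deltaMat X m)ᵀ

/-- The space of harmonicSp `i`-cochains `H_i = Z_i ∩ Z^i = ker ∂_i ∩ ker δ_i`. -/
def harmonicSp (X : SC V) (i : ℕ) : Submodule ℝ (Face X (i + 1) → ℝ) :=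
  LinearMap.ker (Matrix.mulVecLin (deltaMat X i)ᵀ) ⊓
    LinearMap.ker (Matrix.mulVecLin (deltaMat X (i + 1)))

/-- The type of all `k`-element subsets of `V`. -/
abbrev KSet (V : Type) [Fintype V] [DecidableEq V] (k : ℕ) := {F : Finset V // F.card = k}

/-- `ε_{F,F'} = [F : F ∩ F'] ⬝ [F' : F ∩ F']`. -/
def eps {V : Type} [DecidableEq V] [LinearOrder V] (F F' : Finset V) : ℝ :=
  inc F (F ∩ F') * inc F' (F ∩ F')

/-- The down-Laplacian `L↓_{k-1}` of the complete complex `K_n^k`, as a matrix indexed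
by all `k`-subsets of the vertex set: diagonal entries `k`, off-diagonal entries
`ε_{F,F'}` (which vanish unless `|F ∩ F'| = k-1`). -/
def Lc (V : Type) [Fintype V] [DecidableEq V] [LinearOrder V] (k : ℕ) :
    Matrix (KSet V k) (KSet V k) ℝ :=
  fun F F' => if F = F' then (k : ℝ) else eps F.1 F'.1

/-- `S` is an independent set of the pure `k`-dimensional complex `X`: it contains
no `k`-dimensional face of `X`. -/
def SC.IsIndep (X : SC V) (k : ℕ) (S : Finset V) : Prop :=
  ∀ H ∈ X.dfaces (k + 1), ¬ H ⊆ S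

/-- The independence number `α(X)` of a pure `k`-dimensional complex. -/
noncomputable def alphaNum (X : SC V) (k : ℕ) : ℕ :=
  sSup {m | ∃ S : Finset V, X.IsIndep k S ∧ S.card = m}

/-- `X` is a pure `k`-dimensional simplicial complex: all faces have dimension at
most `k` and every face is contained in a face of dimension `k`. -/
def SC.Pure (X : SC V) (k : ℕ) : Prop :=
  (∀ F ∈ X.faces, F.card ≤ k + 1) ∧ ∀ F ∈ X.faces, ∃ H ∈ X.dfaces (k + 1), F ⊆ H

/-- Feasibility for the primal semidefinite program defining `ϑ_k(X)`. -/
def thetaFeasible (X : SC V) (k : ℕ) (Y : Matrix (KSet V k) (KSet V k) ℝ) : Prop :=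
  Y.PosSemidef ∧ Matrix.trace Y = 1 ∧
  (∀ F F' : KSet V k, F.1 ∪ F'.1 ∈ X.dfaces (k + 1) → Y F F' = 0) ∧
  (∀ F F' : KSet V k, k + 2 ≤ (F.1 ∪ F'.1).card → Y F F' = 0) ∧
  (∀ F F' G G' : KSet V k, F.1 ∪ F'.1 = G.1 ∪ G'.1 →
    eps F.1 F'.1 * Y F F' = eps G.1 G'.1 * Y G G')

/-- The theta number `ϑ_k(X)` of a pure `k`-dimensional simplicial complex: the optimal
value of the semidefinite program maximizing `⟨L↓_{k-1}, Y⟩` over feasible `Y`. -/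
noncomputable def theta (X : SC V) (k : ℕ) : ℝ :=
  sSup {t | ∃ Y, thetaFeasible X k Y ∧ Matrix.trace (Lc V k * Y) = t}

/-- The complete `k`-dimensional complex on the vertex type `V`: all subsets of
cardinality at most `k+1` are faces. -/
def completeComplex (V : Type) [Fintype V] [DecidableEq V] (k : ℕ) : SC V :=
  ⟨univ.filter fun F => F.card ≤ k + 1, by
    intro F hF K hK
    simp only [mem_filter, mem_univ, true_and] at hF ⊢
    exact le_trans (card_le_card hK) hF⟩

/-- The empty complex (no faces at all), conventionally pure of any dimension. -/
def emptyComplex (V : Type) [DecidableEq V] : SC V :=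
  ⟨∅, by intro F hF; simp at hF⟩

/-- The largest eigenvalue of a matrix. -/
noncomputable def lambdaMax {ι : Type} [Fintype ι] (M : Matrix ι ι ℝ) : ℝ :=
  sSup {μ : ℝ | Module.End.HasEigenvalue (Matrix.mulVecLin M) μ}

/-- The smallest eigenvalue of a matrix. -/
noncomputable def lambdaMin {ι : Type} [Fintype ι] (M : Matrix ι ι ℝ) : ℝ :=
  sInf {μ : ℝ | Module.End.HasEigenvalue (Matrix.mulVecLin M) μ}

/-- The degree of a face `F`: the number of faces of one higher dimension containing it. -/
def SC.deg (X : SC V) (F : Finset V) : ℕ :=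
  ((X.dfaces (F.card + 1)).filter fun H => F ⊆ H).card

/-- The minimal degree of a `(k-1)`-dimensional face (a face of cardinality `k`). -/
noncomputable def degMin (X : SC V) (k : ℕ) : ℕ :=
  sInf {m | ∃ F ∈ X.dfaces k, m = X.deg F}

/-- The up-Laplacian `L↑_{k-1}(X)` extended by zeros to a matrix indexed by all
`k`-subsets of the vertex set. -/
def LupE (X : SC V) (k : ℕ) : Matrix (KSet V k) (KSet V k) ℝ :=
  fun F F' => ∑ H ∈ X.dfaces (k + 1), inc H F.1 * inc H F'.1

/-- The down-Laplacian `L↓_{k-1}(X)` extended by zeros to a matrix indexed by all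
`k`-subsets of the vertex set. -/
def LdownE (X : SC V) (k : ℕ) : Matrix (KSet V k) (KSet V k) ℝ :=
  fun F F' =>
    if F.1 ∈ X.faces ∧ F'.1 ∈ X.faces then ∑ K ∈ X.dfaces (k - 1), inc F.1 K * inc F'.1 K
    else 0

/-- The Lovász theta number of a graph given by an adjacency relation `adj` on a finite
vertex type, in its primal formulation. -/
noncomputable def thetaG {W : Type} [Fintype W] (adj : W → W → Prop) : ℝ :=
  sSup {t | ∃ Z : Matrix W W ℝ, Z.PosSemidef ∧ Matrix.trace Z = 1 ∧
    (∀ v w, adj v w → Z v w = 0) ∧ t = ∑ v, ∑ w, Z v w}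

/-- The complete tripartite 2-complex `K²_{m,m,m}` on `3m` vertices: the three parts are
the fibers of `v ↦ v / m`, the 2-faces are the triangles with one vertex in each part,
and the 1-faces are the edges with at most one vertex in each part. -/
def tripartite (m : ℕ) : SC (Fin (3 * m)) :=
  ⟨univ.filter fun F => F.card ≤ 3 ∧ ∀ v ∈ F, ∀ w ∈ F, v ≠ w → v.val / m ≠ w.val / m, by
    intro F hF K hK
    simp only [mem_filter, mem_univ, true_and] at hF ⊢
    exact ⟨le_trans (card_le_card hK) hF.1,
      fun v hv w hw hvw => hF.2 v (hK hv) w (hK hw) hvw⟩⟩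

section core
variable {E : Type} [NormedAddCommGroup E] [InnerProductSpace ℝ E]

theorem core_S1 {m : ℕ} (y : Fin m → Fin m → E) (anti : ∀ a b, y b a = - y a b) :
    ∑ a, ∑ b, ∑ c, ‖y a b + y b c + y c a‖ ^ 2
      = 3 * m * ∑ a, ∑ b, ‖y a b‖ ^ 2 - 6 * ∑ a, ‖∑ b, y a b‖ ^ 2 := by
  have h1 : ∀ a b c, ‖y a b + y b c + y c a‖ ^ 2 = ‖y a b‖ ^ 2 + ‖y b c‖ ^ 2 + ‖y c a‖ ^ 2
      - 2 * inner ℝ (y b a) (y b c) - 2 * inner ℝ (y c b) (y c a) - 2 * inner ℝ (y a b) (y a c) := by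
    intro a b c
    rw [norm_add_sq_real, norm_add_sq_real, inner_add_left, anti a b, anti b c, anti c a]
    simp only [inner_neg_left, inner_neg_right]
    rw [real_inner_comm (y c a) (y a b)]
    ring
  have h2 : ∀ a, ‖∑ b, y a b‖ ^ 2 = ∑ b, ∑ c, inner ℝ (y a b) (y a c) := by
    intro a
    rw [← real_inner_self_eq_norm_sq, sum_inner]
    simp only [inner_sum]
  simp only [h1, h2, Finset.sum_add_distrib, Finset.sum_sub_distrib, ← Finset.mul_sum]
  have e1 : ∑ a : Fin m, ∑ b : Fin m, ∑ c : Fin m, ‖y a b‖ ^ 2 = m * ∑ a, ∑ b, ‖y a b‖ ^ 2 := by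
    simp [Finset.mul_sum]
  have e2 : ∑ a : Fin m, ∑ b : Fin m, ∑ c : Fin m, ‖y b c‖ ^ 2 = m * ∑ a, ∑ b, ‖y a b‖ ^ 2 := by
    simp
  have e3 : ∑ a : Fin m, ∑ b : Fin m, ∑ c : Fin m, ‖y c a‖ ^ 2 = m * ∑ a, ∑ b, ‖y a b‖ ^ 2 := by
    simp only [Finset.sum_const, Finset.card_univ, Fintype.card_fin, nsmul_eq_mul, ← Finset.mul_sum]
    rw [Finset.sum_comm]
  have e4 : ∑ a : Fin m, ∑ b : Fin m, ∑ c : Fin m, inner ℝ (y b a) (y b c)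
      = ∑ a, ∑ b, ∑ c, inner ℝ (y a b) (y a c) := Finset.sum_comm
  have e5 : ∑ a : Fin m, ∑ b : Fin m, ∑ c : Fin m, inner ℝ (y c b) (y c a)
      = ∑ a, ∑ b, ∑ c, inner ℝ (y a b) (y a c) := by
    rw [Finset.sum_comm]
    rw [Finset.sum_congr rfl (fun b _ => Finset.sum_comm)]
    rw [Finset.sum_comm]
  rw [e1, e2, e3, e4, e5]
  ring

theorem core_S2 {m : ℕ} (y : Fin m → Fin m → E) (h : Fin m → E) (anti : ∀ a b, y b a = - y a b) :
    ∑ a, ∑ b, ‖(m : ℝ) • y a b - (h a - h b)‖ ^ 2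
      = m ^ 2 * ∑ a, ∑ b, ‖y a b‖ ^ 2 - 4 * m * ∑ a, inner ℝ (∑ b, y a b) (h a)
        + 2 * m * ∑ a, ‖h a‖ ^ 2 - 2 * ‖∑ a, h a‖ ^ 2 := by
  have h1 : ∀ a b, ‖(m : ℝ) • y a b - (h a - h b)‖ ^ 2 = m ^ 2 * ‖y a b‖ ^ 2
      - 2 * m * inner ℝ (y a b) (h a) - 2 * m * inner ℝ (y b a) (h b)
      + ‖h a‖ ^ 2 + ‖h b‖ ^ 2 - 2 * inner ℝ (h a) (h b) := by
    intro a b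
    rw [norm_sub_sq_real, norm_sub_sq_real, norm_smul, anti a b, inner_sub_right]
    simp only [inner_neg_left, real_inner_smul_left, mul_pow, Real.norm_eq_abs, sq_abs]
    ring
  have h2 : ‖∑ a, h a‖ ^ 2 = ∑ a, ∑ b, inner ℝ (h a) (h b) := by
    rw [← real_inner_self_eq_norm_sq, sum_inner]
    simp only [inner_sum]
  have e1 : ∑ a : Fin m, ∑ b : Fin m, inner ℝ (y b a) (h b)
      = ∑ a, ∑ b, inner ℝ (y a b) (h a) := Finset.sum_comm
  simp only [h1, h2, Finset.sum_add_distrib, Finset.sum_sub_distrib, ← Finset.mul_sum, e1, sum_inner]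
  simp only [Finset.sum_const, Finset.card_univ, Fintype.card_fin, nsmul_eq_mul, ← Finset.mul_sum]
  ring

theorem core_S3 {m : ℕ} (z : Fin m → Fin m → E) :
    ∑ a, ∑ b, ‖(m : ℝ) ^ 2 • z a b - (m : ℝ) • (∑ b', z a b') - (m : ℝ) • (∑ a', z a' b)
        + ∑ a', ∑ b', z a' b'‖ ^ 2
      = m ^ 4 * ∑ a, ∑ b, ‖z a b‖ ^ 2 - m ^ 3 * ∑ a, ‖∑ b, z a b‖ ^ 2
        - m ^ 3 * ∑ b, ‖∑ a, z a b‖ ^ 2 + m ^ 2 * ‖∑ a, ∑ b, z a b‖ ^ 2 := by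
  set r : Fin m → E := fun a => ∑ b', z a b' with hr
  set c : Fin m → E := fun b => ∑ a', z a' b with hc
  set t : E := ∑ a', ∑ b', z a' b' with ht
  have h1 : ∀ a b, ‖(m : ℝ) ^ 2 • z a b - (m : ℝ) • r a - (m : ℝ) • c b + t‖ ^ 2
      = m ^ 4 * ‖z a b‖ ^ 2 + m ^ 2 * ‖r a‖ ^ 2 + m ^ 2 * ‖c b‖ ^ 2 + ‖t‖ ^ 2
        - 2 * m ^ 3 * inner ℝ (z a b) (r a) - 2 * m ^ 3 * inner ℝ (z a b) (c b)
        + 2 * m ^ 2 * inner ℝ (z a b) t + 2 * m ^ 2 * inner ℝ (r a) (c b)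
        - 2 * m * inner ℝ (r a) t - 2 * m * inner ℝ (c b) t := by
    intro a b
    rw [norm_add_sq_real, norm_sub_sq_real, norm_sub_sq_real]
    simp only [norm_smul, inner_sub_left, real_inner_smul_left, real_inner_smul_right, mul_pow,
      Real.norm_eq_abs, sq_abs, abs_pow]
    ring
  have q1 : ∑ a, ∑ b, inner ℝ (z a b) (r a) = ∑ a, ‖r a‖ ^ 2 := by
    refine Finset.sum_congr rfl fun a _ => ?_
    rw [← sum_inner, ← real_inner_self_eq_norm_sq]
  have q2 : ∑ a, ∑ b, inner ℝ (z a b) (c b) = ∑ b, ‖c b‖ ^ 2 := by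
    rw [Finset.sum_comm]
    refine Finset.sum_congr rfl fun a _ => ?_
    rw [← sum_inner, ← real_inner_self_eq_norm_sq]
  have q3 : ∑ a, ∑ b, inner ℝ (z a b) t = ‖t‖ ^ 2 := by
    simp only [← sum_inner]
    rw [← real_inner_self_eq_norm_sq]
  have tr : ∑ a, r a = t := rfl
  have tc : ∑ b, c b = t := by rw [ht, Finset.sum_comm]
  have q4 : ∑ a, ∑ b, inner ℝ (r a) (c b) = ‖t‖ ^ 2 := by
    simp only [← inner_sum, ← sum_inner, tr, tc]
    rw [← real_inner_self_eq_norm_sq]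
  have q5 : ∑ a, inner ℝ (r a) t = ‖t‖ ^ 2 := by
    rw [← sum_inner, tr, real_inner_self_eq_norm_sq]
  have q6 : ∑ a, inner ℝ (c a) t = ‖t‖ ^ 2 := by
    rw [← sum_inner, tc, real_inner_self_eq_norm_sq]
  change ∑ a, ∑ b, ‖(m : ℝ) ^ 2 • z a b - (m : ℝ) • r a - (m : ℝ) • c b + t‖ ^ 2
      = m ^ 4 * ∑ a, ∑ b, ‖z a b‖ ^ 2 - m ^ 3 * ∑ a, ‖r a‖ ^ 2
        - m ^ 3 * ∑ b, ‖c b‖ ^ 2 + m ^ 2 * ‖t‖ ^ 2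
  simp only [h1, Finset.sum_add_distrib, Finset.sum_sub_distrib, ← Finset.mul_sum, q1, q2, q3, q4]
  simp only [Finset.sum_const, Finset.card_univ, Fintype.card_fin, nsmul_eq_mul, ← Finset.mul_sum,
    q5, q6]
  ring

theorem core_upper {m : ℕ} (hm : 1 ≤ m) (x : Fin 3 × Fin m → Fin 3 × Fin m → E)
    (anti : ∀ u v, x v u = - x u v)
    (P1 : ∀ u v u' v', u ≠ u' → u ≠ v' → v ≠ u' → v ≠ v' → u ≠ v → u' ≠ v' →
      inner ℝ (x u v) (x u' v') = 0)
    (P2 : ∀ u v w, u.1 ≠ v.1 → u.1 ≠ w.1 → v.1 ≠ w.1 → inner ℝ (x u v) (x u w) = 0)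
    (P3 : ∀ u v w, u ≠ v → u ≠ w → v ≠ w →
      inner ℝ (x u v) (x u w) = inner ℝ (x v u) (x v w)) :
    ∑ u, ‖∑ v, x u v‖ ^ 2 ≤ m * ∑ u, ∑ v, ‖x u v‖ ^ 2 := by
  have x0 : ∀ u, x u u = 0 := by
    intro u
    have h := anti u u
    rw [eq_neg_iff_add_eq_zero, ← two_smul ℝ, smul_eq_zero] at h
    simpa using h
  set R : Fin 3 → Fin m → Fin 3 → E := fun i a j => ∑ b, x (i, a) (j, b) with hR
  set T : Fin 3 → Fin 3 → ℝ := fun i j => ∑ a, ∑ b, ‖x (i, a) (j, b)‖ ^ 2 with hT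
  set N : Fin 3 → Fin 3 → ℝ := fun i j => ∑ a, ‖R i a j‖ ^ 2 with hN
  set tot : Fin 3 → Fin 3 → E := fun i j => ∑ a, R i a j with htot
  have Tsymm : ∀ i j, T i j = T j i := by
    intro i j
    simp only [hT]
    rw [Finset.sum_comm]
    refine Finset.sum_congr rfl fun a _ => Finset.sum_congr rfl fun b _ => ?_
    rw [anti (j, a) (i, b), norm_neg]
  have col : ∀ i j b, ∑ a, x (i, a) (j, b) = - R j b i := by
    intro i j b
    simp only [hR, ← Finset.sum_neg_distrib]
    exact Finset.sum_congr rfl fun a _ => anti _ _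
  have A : ∀ i j k a, i ≠ j → i ≠ k → j ≠ k → inner ℝ (R i a j) (R i a k) = 0 := by
    intro i j k a h1 h2 h3
    simp only [hR, sum_inner, inner_sum]
    exact Finset.sum_eq_zero fun b _ => Finset.sum_eq_zero fun c _ => P2 _ _ _ h1 h2 h3
  have B : ∀ i j k, i ≠ j → i ≠ k → j ≠ k → inner ℝ (tot i j) (tot i k) = 0 := by
    intro i j k h1 h2 h3
    simp only [htot, sum_inner, inner_sum]
    refine Finset.sum_eq_zero fun a _ => Finset.sum_eq_zero fun a' _ => ?_
    by_cases h : a = a'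
    · subst h; exact A _ _ _ _ h1 h2 h3
    · simp only [hR, sum_inner, inner_sum]
      refine Finset.sum_eq_zero fun b _ => Finset.sum_eq_zero fun c _ => P1 _ _ _ _ ?_ ?_ ?_ ?_ ?_ ?_
      all_goals simp only [ne_eq, Prod.mk.injEq, not_and]
      all_goals grind
  have C : ∀ i j, i ≠ j → ‖tot i j‖ ^ 2 = N i j + N j i - T i j := by
    intro i j hij
    have h1 : ∀ a b, inner ℝ (x (i, a) (j, b)) (tot i j)
        = inner ℝ (x (i, a) (j, b)) (R i a j) - inner ℝ (x (i, a) (j, b)) (R j b i)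
          - ‖x (i, a) (j, b)‖ ^ 2 := by
      intro a b
      have h2 : ∀ a' b', inner ℝ (x (i, a) (j, b)) (x (i, a') (j, b'))
          = (if a' = a then inner ℝ (x (i, a) (j, b)) (x (i, a) (j, b')) else 0)
            + (if b' = b then inner ℝ (x (i, a) (j, b)) (x (i, a') (j, b)) else 0)
            - (if a' = a then (if b' = b then ‖x (i, a) (j, b)‖ ^ 2 else 0) else 0) := by
        intro a' b'
        by_cases ha : a' = a <;> by_cases hb : b' = b
        · subst ha; subst hb; simp
        · subst ha; simp [hb]
        · subst hb; simp [ha]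
        · simp only [ha, hb, if_false]
          rw [P1]
          · simp
          all_goals simp only [ne_eq, Prod.mk.injEq, not_and]
          all_goals grind
      have h3 : inner ℝ (x (i, a) (j, b)) (R j b i)
          = - ∑ a', inner ℝ (x (i, a) (j, b)) (x (i, a') (j, b)) := by
        rw [← inner_sum, col, inner_neg_right, neg_neg]
      rw [h3]
      simp only [htot, hR, inner_sum]
      rw [Finset.sum_congr rfl fun a' _ => Finset.sum_congr rfl fun b' _ => h2 a' b']
      simp only [Finset.sum_add_distrib, Finset.sum_sub_distrib]
      simp only [Finset.sum_ite_eq', Finset.mem_univ, if_true]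
      rw [Finset.sum_comm]
      simp
    have h4 : ‖tot i j‖ ^ 2 = ∑ a, ∑ b, inner ℝ (x (i, a) (j, b)) (tot i j) := by
      simp only [← sum_inner]
      rw [← real_inner_self_eq_norm_sq]
    rw [h4]
    simp only [h1, Finset.sum_sub_distrib]
    have h5 : ∑ a, ∑ b, inner ℝ (x (i, a) (j, b)) (R i a j) = N i j := by
      refine Finset.sum_congr rfl fun a _ => ?_
      rw [← sum_inner, ← real_inner_self_eq_norm_sq]
    have h6 : ∑ a, ∑ b, inner ℝ (x (i, a) (j, b)) (R j b i) = - N j i := by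
      rw [Finset.sum_comm]
      simp only [hN, ← Finset.sum_neg_distrib]
      refine Finset.sum_congr rfl fun b _ => ?_
      rw [← sum_inner, col, inner_neg_left, real_inner_self_eq_norm_sq]
    rw [h5, h6]
    ring
  have D : ∀ i j, i ≠ j → ∑ a, inner ℝ (R i a i) (R i a j) = N j i - T i j := by
    intro i j hij
    have h1 : ∀ a a' b, inner ℝ (x (i, a) (i, a')) (x (i, a) (j, b))
        = inner ℝ (x (j, b) (i, a)) (x (j, b) (i, a'))
          - (if a' = a then ‖x (j, b) (i, a)‖ ^ 2 else 0) := by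
      intro a a' b
      by_cases h : a' = a
      · subst h; simp [x0]
      · simp only [h, if_false, sub_zero]
        rw [real_inner_comm, P3]
        all_goals simp only [ne_eq, Prod.mk.injEq, not_and]
        all_goals grind
    rw [Tsymm i j]
    simp only [hN, hT, hR, ← real_inner_self_eq_norm_sq, sum_inner, inner_sum]
    have h2 : ∀ a, ∑ b, ∑ a', inner ℝ (x (i, a) (i, a')) (x (i, a) (j, b))
      = ∑ b, (∑ a', inner ℝ (x (j, b) (i, a)) (x (j, b) (i, a')) - ‖x (j, b) (i, a)‖ ^ 2) := by
      intro a
      refine Finset.sum_congr rfl fun b _ => ?_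
      simp only [h1, Finset.sum_sub_distrib]
      simp
    simp only [h2]
    rw [Finset.sum_comm]
    simp only [Finset.sum_sub_distrib, real_inner_self_eq_norm_sq]
    congr 1
    refine Finset.sum_congr rfl fun b _ => ?_
    first
      | rfl
      | (rw [Finset.sum_comm])
  -- consequences for a triple of distinct parts
  have mpos : (0 : ℝ) < m := by exact_mod_cast hm
  have main : ∀ i j k : Fin 3, i ≠ j → i ≠ k → j ≠ k →
      (∑ a, ‖R i a i + R i a j + R i a k‖ ^ 2
        = N i i + N i j + N i k + 2 * (N j i - T i j) + 2 * (N k i - T i k)) ∧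
      0 ≤ (m : ℝ) * T i i - 2 * N i i ∧
      0 ≤ m ^ 2 * T i i - 4 * m * ((N j i - T i j) + (N k i - T i k)) + 2 * m * (N i j + N i k)
        - 2 * ((N i j + N j i - T i j) + (N i k + N k i - T i k)) := by
    intro i j k hij hik hjk
    refine ⟨?_, ?_, ?_⟩
    · rw [← D i j hij, ← D i k hik]
      simp only [hN, Finset.mul_sum, ← Finset.sum_add_distrib]
      refine Finset.sum_congr rfl fun a _ => ?_
      rw [norm_add_sq_real, norm_add_sq_real, inner_add_left, A i j k a hij hik hjk]
      ring
    · have := core_S1 (fun a b => x (i, a) (i, b)) (fun a b => anti _ _)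
      have h0 : 0 ≤ ∑ a, ∑ b, ∑ c, ‖x (i, a) (i, b) + x (i, b) (i, c) + x (i, c) (i, a)‖ ^ 2 := by
        positivity
      rw [this] at h0
      change 0 ≤ 3 * (m : ℝ) * T i i - 6 * N i i at h0
      linarith
    · have := core_S2 (fun a b => x (i, a) (i, b)) (fun a => R i a j + R i a k)
        (fun a b => anti _ _)
      have h0 : 0 ≤ ∑ a, ∑ b, ‖(m : ℝ) • x (i, a) (i, b)
          - ((R i a j + R i a k) - (R i b j + R i b k))‖ ^ 2 := by
        positivity
      rw [this] at h0
      have e1 : ∑ a, ‖R i a j + R i a k‖ ^ 2 = N i j + N i k := by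
        simp only [hN, ← Finset.sum_add_distrib]
        refine Finset.sum_congr rfl fun a _ => ?_
        rw [norm_add_sq_real, A i j k a hij hik hjk]
        ring
      have e2 : ‖∑ a, (R i a j + R i a k)‖ ^ 2
          = (N i j + N j i - T i j) + (N i k + N k i - T i k) := by
        rw [Finset.sum_add_distrib, ← C i j hij, ← C i k hik]
        change ‖tot i j + tot i k‖ ^ 2 = _
        rw [norm_add_sq_real, B i j k hij hik hjk]
        ring
      have e3 : ∑ a, inner ℝ (∑ b, x (i, a) (i, b)) (R i a j + R i a k)
          = (N j i - T i j) + (N k i - T i k) := by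
        rw [← D i j hij, ← D i k hik]
        simp only [inner_add_right, Finset.sum_add_distrib]
        rfl
      rw [e1, e2, e3] at h0
      exact h0
  have cross : ∀ i j : Fin 3, i ≠ j →
      0 ≤ m ^ 2 * T i j - m * N i j - m * N j i + (N i j + N j i - T i j) := by
    intro i j hij
    have := core_S3 (fun a b => x (i, a) (j, b))
    have h0 : 0 ≤ ∑ a, ∑ b, ‖(m : ℝ) ^ 2 • x (i, a) (j, b) - (m : ℝ) • (∑ b', x (i, a) (j, b'))
        - (m : ℝ) • (∑ a', x (i, a') (j, b)) + ∑ a', ∑ b', x (i, a') (j, b')‖ ^ 2 := by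
      positivity
    rw [this] at h0
    simp only [col, norm_neg] at h0
    change 0 ≤ (m : ℝ) ^ 4 * T i j - m ^ 3 * N i j - m ^ 3 * N j i + m ^ 2 * ‖tot i j‖ ^ 2 at h0
    rw [C i j hij] at h0
    have : 0 ≤ (m : ℝ) ^ 2 * (m ^ 2 * T i j - m * N i j - m * N j i + (N i j + N j i - T i j)) := by
      linarith
    exact nonneg_of_mul_nonneg_right this (by positivity)
  have L1 : ∑ u, ‖∑ v, x u v‖ ^ 2 = (∑ a, ‖R 0 a 0 + R 0 a 1 + R 0 a 2‖ ^ 2)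
      + (∑ a, ‖R 1 a 1 + R 1 a 0 + R 1 a 2‖ ^ 2) + (∑ a, ‖R 2 a 2 + R 2 a 0 + R 2 a 1‖ ^ 2) := by
    simp only [Fintype.sum_prod_type, Fin.sum_univ_three]
    refine congrArg₂ _ (congrArg₂ _ rfl ?_) ?_
    · refine Finset.sum_congr rfl fun a _ => ?_
      rw [show R 1 a 1 + R 1 a 0 + R 1 a 2 = R 1 a 0 + R 1 a 1 + R 1 a 2 by abel]
    · refine Finset.sum_congr rfl fun a _ => ?_
      rw [show R 2 a 2 + R 2 a 0 + R 2 a 1 = R 2 a 0 + R 2 a 1 + R 2 a 2 by abel]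
  have L2 : ∑ u, ∑ v, ‖x u v‖ ^ 2 = T 0 0 + T 1 1 + T 2 2 + 2 * T 0 1 + 2 * T 0 2 + 2 * T 1 2 := by
    have : ∑ u, ∑ v, ‖x u v‖ ^ 2 = (T 0 0 + T 0 1 + T 0 2) + (T 1 0 + T 1 1 + T 1 2)
        + (T 2 0 + T 2 1 + T 2 2) := by
      simp only [Fintype.sum_prod_type, Fin.sum_univ_three, Finset.sum_add_distrib, hT]
      ring
    rw [this, Tsymm 1 0, Tsymm 2 0, Tsymm 2 1]
    ring
  obtain ⟨a0, b0, c0⟩ := main 0 1 2 (by decide) (by decide) (by decide)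
  obtain ⟨a1, b1, c1⟩ := main 1 0 2 (by decide) (by decide) (by decide)
  obtain ⟨a2, b2, c2⟩ := main 2 0 1 (by decide) (by decide) (by decide)
  have d0 := cross 0 1 (by decide)
  have d1 := cross 0 2 (by decide)
  have d2 := cross 1 2 (by decide)
  rw [L1, L2, a0, a1, a2]
  rw [Tsymm 1 0] at *
  rw [Tsymm 2 0, Tsymm 2 1] at *
  have b0' := mul_nonneg mpos.le b0
  have b1' := mul_nonneg mpos.le b1
  have b2' := mul_nonneg mpos.le b2
  refine le_of_mul_le_mul_left ?_ mpos
  nlinarith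
end core
section pairs
variable {n : ℕ}

/-- sign of an ordered pair of vertices -/
def sg (u v : Fin n) : ℝ := if u = v then 0 else if u < v then 1 else -1

theorem sg_anti (u v : Fin n) : sg v u = - sg u v := by
  unfold sg
  rcases lt_trichotomy u v with h | h | h
  · simp [h, h.ne, h.ne', h.not_gt]
  · simp [h]
  · simp [h, h.ne, h.ne', h.not_gt]

theorem sg_sq {u v : Fin n} (h : u ≠ v) : sg u v ^ 2 = 1 := by
  unfold sg
  rw [if_neg h]
  split_ifs <;> norm_num

theorem inc_pair {u v : Fin n} (h : u ≠ v) : inc ({u, v} : Finset (Fin n)) {u} = - sg u v := by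
  unfold inc
  have h1 : ({u, v} : Finset (Fin n)) \ {u} = {v} := by
    ext w; simp only [Finset.mem_sdiff, Finset.mem_insert, Finset.mem_singleton]; grind
  rw [if_pos ⟨by simp, by rw [Finset.card_pair h, Finset.card_singleton]⟩, h1, Finset.sum_singleton,
    Finset.filter_singleton]
  unfold sg
  rw [if_neg h]
  split_ifs <;> simp

theorem inc_not_mem {F : Finset (Fin n)} {u : Fin n} (h : u ∉ F) : inc F {u} = 0 := by
  unfold inc
  rw [if_neg]
  simp [h]

theorem exists_pair {F : Finset (Fin n)} (hF : F.card = 2) {u : Fin n} (h : u ∈ F) :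
    ∃ v, u ≠ v ∧ F = {u, v} := by
  obtain ⟨a, b, hab, rfl⟩ := Finset.card_eq_two.mp hF
  simp only [Finset.mem_insert, Finset.mem_singleton] at h
  rcases h with rfl | rfl
  · exact ⟨b, hab, rfl⟩
  · exact ⟨a, hab.symm, Finset.pair_comm _ _⟩

theorem inc_sq {F : Finset (Fin n)} (hF : F.card = 2) {u : Fin n} (h : u ∈ F) :
    inc F {u} * inc F {u} = 1 := by
  obtain ⟨v, huv, rfl⟩ := exists_pair hF h
  rw [inc_pair huv]
  have := sg_sq huv
  linarith

theorem eps_inter {F F' : Finset (Fin n)} {p : Fin n} (h : F ∩ F' = {p}) :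
    eps F F' = inc F {p} * inc F' {p} := by
  unfold eps; rw [h]

theorem eps_pair {u v w : Fin n} (huv : u ≠ v) (huw : u ≠ w) (hvw : v ≠ w) :
    eps ({u, v} : Finset (Fin n)) {u, w} = sg u v * sg u w := by
  rw [eps_inter (p := u), inc_pair huv, inc_pair huw]
  · ring
  · ext z; simp only [Finset.mem_inter, Finset.mem_insert, Finset.mem_singleton]; grind

theorem eps_zero {F F' : Finset (Fin n)} (hF : F.card = 2) (h : (F ∩ F').card ≠ 1) :
    eps F F' = 0 := by
  unfold eps
  have : inc F (F ∩ F') = 0 := by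
    unfold inc
    rw [if_neg]
    rintro ⟨_, h2⟩
    omega
  rw [this, zero_mul]

theorem Lc_eq (F F' : KSet (Fin n) 2) :
    Lc (Fin n) 2 F F' = ∑ u, inc F.1 {u} * inc F'.1 {u} := by
  unfold Lc
  have hz : ∀ u, u ∉ F.1 ∩ F'.1 → inc F.1 {u} * inc F'.1 {u} = 0 := by
    intro u hu
    by_cases h : u ∈ F.1
    · have : u ∉ F'.1 := fun h' => hu (Finset.mem_inter.mpr ⟨h, h'⟩)
      rw [inc_not_mem this, mul_zero]
    · rw [inc_not_mem h, zero_mul]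
  have hs : ∑ u, inc F.1 {u} * inc F'.1 {u} = ∑ u ∈ F.1 ∩ F'.1, inc F.1 {u} * inc F'.1 {u} :=
    (Finset.sum_subset (Finset.subset_univ _) fun u _ hu => hz u hu).symm
  rw [hs]
  by_cases h : F = F'
  · subst h
    rw [if_pos rfl, Finset.inter_self, Finset.sum_congr rfl fun u hu => inc_sq F.2 hu]
    simp [F.2]
  · rw [if_neg h]
    by_cases hc : (F.1 ∩ F'.1).card = 1
    · obtain ⟨p, hp⟩ := Finset.card_eq_one.mp hc
      rw [eps_inter hp, hp, Finset.sum_singleton]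
    · rw [eps_zero F.2 hc]
      have hle : (F.1 ∩ F'.1).card ≤ 2 := 
        (Finset.card_le_card Finset.inter_subset_left).trans F.2.le
      have h2 : (F.1 ∩ F'.1).card ≠ 2 := by
        intro h2
        apply h
        have e1 := Finset.eq_of_subset_of_card_le (Finset.inter_subset_left (s₁ := F.1) (s₂ := F'.1))
          (by rw [h2, F.2])
        have e2 := Finset.eq_of_subset_of_card_le (Finset.inter_subset_right (s₁ := F.1) (s₂ := F'.1))
          (by rw [h2, F'.2])
        exact Subtype.ext (e1.symm.trans e2)
      have h0 : F.1 ∩ F'.1 = ∅ := Finset.card_eq_zero.mp (by omega)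
      rw [h0, Finset.sum_empty]

/-- the pair `{u,v}` as an element of `KSet` -/
def mkp (u v : Fin n) (h : u ≠ v) : KSet (Fin n) 2 := ⟨{u, v}, Finset.card_pair h⟩

theorem mkp_comm (u v : Fin n) (h : u ≠ v) : mkp v u h.symm = mkp u v h :=
  Subtype.ext (Finset.pair_comm _ _)

theorem sum_pairs {M : Type} [AddCommMonoid M] (u : Fin n) (g : KSet (Fin n) 2 → M) :
    ∑ v, (if h : u ≠ v then g (mkp u v h) else 0) = ∑ F : KSet (Fin n) 2, if u ∈ F.1 then g F else 0 := by
  rw [← Finset.sum_filter]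
  rw [Finset.sum_dite, Finset.sum_const_zero, add_zero]
  refine Finset.sum_bij (fun v _ => mkp u v.1 ((Finset.mem_filter.mp v.2).2)) ?_ ?_ ?_ ?_
  · intro v _; simp [mkp]
  · intro v _ w _ h
    have hv : u ≠ v.1 := (Finset.mem_filter.mp v.2).2
    have hw : u ≠ w.1 := (Finset.mem_filter.mp w.2).2
    have := congrArg Subtype.val h
    simp only [mkp] at this
    have h3 : v.1 ∈ ({u, w.1} : Finset (Fin n)) := by rw [← this]; simp
    simp only [Finset.mem_insert, Finset.mem_singleton] at h3
    exact Subtype.ext (h3.resolve_left hv.symm)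
  · intro F hF
    obtain ⟨v, huv, h⟩ := exists_pair F.2 (by simpa using hF)
    exact ⟨⟨v, by simpa using huv⟩, Finset.mem_univ _, Subtype.ext h.symm⟩
  · intro v _; rfl

theorem sum_sum_pairs (g : KSet (Fin n) 2 → ℝ) :
    ∑ u, ∑ v, (if h : u ≠ v then g (mkp u v h) else 0) = 2 * ∑ F, g F := by
  simp only [sum_pairs]
  rw [Finset.sum_comm, Finset.mul_sum]
  refine Finset.sum_congr rfl fun F _ => ?_
  simp [F.2]

section up
variable {E : Type} [NormedAddCommGroup E] [InnerProductSpace ℝ E]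

/-- antisymmetric extension of a family of vectors indexed by pairs -/
def extv (x : KSet (Fin n) 2 → E) (u v : Fin n) : E :=
  if h : u ≠ v then sg u v • x (mkp u v h) else 0

theorem extv_anti (x : KSet (Fin n) 2 → E) (u v : Fin n) : extv x v u = - extv x u v := by
  unfold extv
  by_cases h : u = v
  · subst h; simp
  · rw [dif_pos h, dif_pos (Ne.symm h), sg_anti, mkp_comm, neg_smul]

theorem extv_norm (x : KSet (Fin n) 2 → E) :
    ∑ u, ∑ v, ‖extv x u v‖ ^ 2 = 2 * ∑ F, ‖x F‖ ^ 2 := by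
  rw [← sum_sum_pairs]
  refine Finset.sum_congr rfl fun u _ => Finset.sum_congr rfl fun v _ => ?_
  unfold extv
  by_cases h : u = v
  · simp [h]
  · rw [dif_pos h, dif_pos h, norm_smul, mul_pow, Real.norm_eq_abs, sq_abs, sg_sq h, one_mul]

theorem extv_star (x : KSet (Fin n) 2 → E) (u : Fin n) :
    ∑ v, extv x u v = - ∑ F : KSet (Fin n) 2, inc F.1 {u} • x F := by
  have h := sum_pairs u (fun F => inc F.1 {u} • x F)
  have h1 : ∑ F : KSet (Fin n) 2, (if u ∈ F.1 then inc F.1 {u} • x F else 0)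
      = ∑ F : KSet (Fin n) 2, inc F.1 {u} • x F := by
    refine Finset.sum_congr rfl fun F _ => ?_
    split_ifs with h
    · rfl
    · rw [inc_not_mem h, zero_smul]
  rw [← h1, ← h, ← Finset.sum_neg_distrib]
  refine Finset.sum_congr rfl fun v _ => ?_
  unfold extv
  by_cases h : u = v
  · simp [h]
  · rw [dif_pos h, dif_pos h]
    simp only [mkp]
    rw [inc_pair h, neg_smul, neg_neg]

theorem extv_obj (x : KSet (Fin n) 2 → E) (Y : Matrix (KSet (Fin n) 2) (KSet (Fin n) 2) ℝ)
    (hY : ∀ F F', inner ℝ (x F) (x F') = Y F F') :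
    ∑ u, ‖∑ v, extv x u v‖ ^ 2 = Matrix.trace (Lc (Fin n) 2 * Y) := by
  simp only [extv_star, norm_neg, ← real_inner_self_eq_norm_sq, sum_inner, inner_sum,
    real_inner_smul_left, real_inner_smul_right, hY, Matrix.trace, Matrix.diag, Matrix.mul_apply,
    Lc_eq, Finset.sum_mul]
  rw [Finset.sum_comm]
  refine Finset.sum_congr rfl fun F _ => ?_
  rw [Finset.sum_comm]
  refine Finset.sum_congr rfl fun F' _ => ?_
  refine Finset.sum_congr rfl fun u _ => ?_
  rw [show Y F' F = Y F F' by rw [← hY, ← hY, real_inner_comm]]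
  ring
end up

open scoped MatrixOrder in
theorem gram {ι : Type} [Fintype ι] [DecidableEq ι] (Y : Matrix ι ι ℝ) (hY : Y.PosSemidef) :
    ∃ x : ι → EuclideanSpace ℝ ι, ∀ F F', inner ℝ (x F) (x F') = Y F F' := by
  obtain ⟨B, rfl⟩ := CStarAlgebra.nonneg_iff_eq_star_mul_self.mp hY.nonneg
  refine ⟨fun F => WithLp.toLp 2 (fun i => B i F), fun F F' => ?_⟩
  simp [PiLp.inner_apply, Matrix.mul_apply, Matrix.star_eq_conjTranspose, Matrix.conjTranspose_apply, mul_comm]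

end pairs

theorem mem_trip {m : ℕ} {F : Finset (Fin (3 * m))} : F ∈ (tripartite m).dfaces 3 ↔
    F.card = 3 ∧ ∀ v ∈ F, ∀ w ∈ F, v ≠ w → v.val / m ≠ w.val / m := by
  simp only [SC.dfaces, tripartite, Finset.mem_filter, Finset.mem_univ, true_and]
  constructor
  · rintro ⟨⟨_, h⟩, h'⟩; exact ⟨h', h⟩
  · rintro ⟨h', h⟩; exact ⟨⟨h'.le, h⟩, h'⟩

theorem trip_triple {m : ℕ} {u v w : Fin (3 * m)} (h1 : u.val / m ≠ v.val / m)
    (h2 : u.val / m ≠ w.val / m) (h3 : v.val / m ≠ w.val / m) :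
    ({u, v, w} : Finset (Fin (3 * m))) ∈ (tripartite m).dfaces 3 := by
  rw [mem_trip]
  have a1 : u ≠ v := fun h => h1 (by rw [h])
  have a2 : u ≠ w := fun h => h2 (by rw [h])
  have a3 : v ≠ w := fun h => h3 (by rw [h])
  refine ⟨Finset.card_eq_three.mpr ⟨u, v, w, a1, a2, a3, rfl⟩, ?_⟩
  intro x hx y hy hxy
  simp only [Finset.mem_insert, Finset.mem_singleton] at hx hy
  rcases hx with rfl | rfl | rfl <;> rcases hy with rfl | rfl | rfl <;>
    first
      | exact absurd rfl hxy
      | assumption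
      | (apply Ne.symm; assumption)

theorem fpf_div {m : ℕ} (u : Fin 3 × Fin m) : (finProdFinEquiv u).val / m = u.1.val := by
  have : 0 < m := u.2.pos
  simp only [finProdFinEquiv_apply_val]
  rw [Nat.add_mul_div_left _ _ this, Nat.div_eq_of_lt u.2.2, zero_add]

theorem theta_upper {m : ℕ} (hm : 1 ≤ m)
    (Y : Matrix (KSet (Fin (3 * m)) 2) (KSet (Fin (3 * m)) 2) ℝ)
    (hY : thetaFeasible (tripartite m) 2 Y) : Matrix.trace (Lc (Fin (3 * m)) 2 * Y) ≤ 2 * m := by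
  obtain ⟨hpsd, htr, hz3, hz4, hsym⟩ := hY
  obtain ⟨x, hx⟩ := gram Y hpsd
  set e := finProdFinEquiv (m := 3) (n := m) with he
  have hstar : ∀ u v w : Fin (3 * m), ∀ (h1 : u ≠ v) (h2 : u ≠ w) (h3 : v ≠ w),
      inner ℝ (extv x u v) (extv x u w)
        = eps (mkp u v h1).1 (mkp u w h2).1 * Y (mkp u v h1) (mkp u w h2) := by
    intro u v w h1 h2 h3
    simp only [extv, dif_pos h1, dif_pos h2, real_inner_smul_left, real_inner_smul_right, hx]
    simp only [mkp]
    rw [eps_pair h1 h2 h3]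
    ring
  have key := core_upper hm (fun u v => extv x (e u) (e v)) (fun u v => extv_anti x _ _)
    (by
      intro u v u' v' h1 h2 h3 h4 h5 h6
      have h5' : e u ≠ e v := e.injective.ne h5
      have h6' : e u' ≠ e v' := e.injective.ne h6
      simp only [extv, dif_pos h5', dif_pos h6', real_inner_smul_left, real_inner_smul_right, hx]
      rw [hz4]
      · simp
      · simp only [mkp]
        rw [Finset.card_union_of_disjoint, Finset.card_pair h5', Finset.card_pair h6']
        simp [h1, h2, h3, h4, eq_comm])
    (by
      intro u v w h1 h2 h3
      have h1' : e u ≠ e v := e.injective.ne (fun h => h1 (by rw [h]))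
      have h2' : e u ≠ e w := e.injective.ne (fun h => h2 (by rw [h]))
      have h3' : e v ≠ e w := e.injective.ne (fun h => h3 (by rw [h]))
      rw [hstar _ _ _ h1' h2' h3', hz3, mul_zero]
      have : (mkp (e u) (e v) h1').1 ∪ (mkp (e u) (e w) h2').1 = {e u, e v, e w} := by
        ext z; simp only [mkp, Finset.mem_union, Finset.mem_insert, Finset.mem_singleton]; grind
      rw [this]
      apply trip_triple <;> rw [he, fpf_div, fpf_div] <;> exact Fin.val_ne_of_ne (by assumption))
    (by
      intro u v w h1 h2 h3
      have h1' : e u ≠ e v := e.injective.ne h1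
      have h2' : e u ≠ e w := e.injective.ne h2
      have h3' : e v ≠ e w := e.injective.ne h3
      rw [hstar _ _ _ h1' h2' h3', hstar _ _ _ h1'.symm h3' h2']
      apply hsym
      ext z; simp only [mkp, Finset.mem_union, Finset.mem_insert, Finset.mem_singleton]; grind)
  have k1 : ∑ u, ‖∑ v, extv x (e u) (e v)‖ ^ 2 = Matrix.trace (Lc (Fin (3 * m)) 2 * Y) := by
    rw [← extv_obj x Y hx, ← Equiv.sum_comp e]
    refine Finset.sum_congr rfl fun u _ => ?_
    rw [← Equiv.sum_comp e]
  have k2 : ∑ u, ∑ v, ‖extv x (e u) (e v)‖ ^ 2 = 2 := by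
    have : ∑ u, ∑ v, ‖extv x (e u) (e v)‖ ^ 2 = ∑ u, ∑ v, ‖extv x u v‖ ^ 2 := by
      rw [← Equiv.sum_comp e]
      refine Finset.sum_congr rfl fun u _ => ?_
      rw [← Equiv.sum_comp e]
    rw [this, extv_norm]
    have h2 : ∑ F, ‖x F‖ ^ 2 = 1 := by
      rw [← htr]
      refine Finset.sum_congr rfl fun F _ => ?_
      rw [← real_inner_self_eq_norm_sq, hx]; rfl
    rw [h2, mul_one]
  rw [k1, k2] at key
  linarith
section low
variable {n : ℕ}

/-- the incidence number restricted to edges inside `S` -/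
def dS (S : Finset (Fin n)) (u : Fin n) (F : KSet (Fin n) 2) : ℝ :=
  if F.1 ⊆ S then inc F.1 {u} else 0

theorem dS_not_mem_S {S : Finset (Fin n)} {u : Fin n} (hu : u ∉ S) (F : KSet (Fin n) 2) :
    dS S u F = 0 := by
  unfold dS
  split_ifs with h
  · exact inc_not_mem fun h' => hu (h h')
  · rfl

theorem dS_not_mem {S : Finset (Fin n)} {u : Fin n} {F : KSet (Fin n) 2} (hu : u ∉ F.1) :
    dS S u F = 0 := by
  unfold dS
  rw [inc_not_mem hu, ite_self]

/-- the vertex Laplacian of the complete graph on `S` -/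
def KS (S : Finset (Fin n)) (u w : Fin n) : ℝ := ∑ F, dS S u F * dS S w F

theorem KS_diag {S : Finset (Fin n)} {u : Fin n} (hu : u ∈ S) : KS S u u = (S.card : ℝ) - 1 := by
  have h1 : KS S u u = ∑ F : KSet (Fin n) 2, if u ∈ F.1 then (if F.1 ⊆ S then (1 : ℝ) else 0) else 0 := by
    refine Finset.sum_congr rfl fun F _ => ?_
    split_ifs with h h'
    · unfold dS; rw [if_pos h', inc_sq F.2 h]
    · unfold dS; rw [if_neg h', mul_zero]
    · rw [dS_not_mem h, mul_zero]
  rw [h1, ← sum_pairs u (fun F => if F.1 ⊆ S then (1 : ℝ) else 0)]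
  have h2 : ∀ v, (if h : u ≠ v then (if (mkp u v h).1 ⊆ S then (1 : ℝ) else 0) else 0)
      = if v ∈ S.erase u then 1 else 0 := by
    intro v
    by_cases h : u = v
    · simp [h]
    · simp [h, mkp, Finset.insert_subset_iff, hu, Ne.symm h]
  simp only [h2]
  rw [Finset.sum_boole]
  simp only [Finset.filter_mem_eq_inter, Finset.univ_inter]
  rw [Finset.card_erase_of_mem hu, Nat.cast_sub (Finset.card_pos.mpr ⟨u, hu⟩), Nat.cast_one]

theorem KS_off {S : Finset (Fin n)} {u w : Fin n} (hu : u ∈ S) (hw : w ∈ S) (h : u ≠ w) :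
    KS S u w ^ 2 = 1 := by
  unfold KS
  rw [Finset.sum_eq_single (mkp u w h)]
  · have hs : (mkp u w h).1 ⊆ S := by simp [mkp, Finset.insert_subset_iff, hu, hw]
    unfold dS
    rw [if_pos hs, if_pos hs]
    have e1 := inc_sq (mkp u w h).2 (u := u) (by simp [mkp])
    have e2 := inc_sq (mkp u w h).2 (u := w) (by simp [mkp])
    rw [mul_pow, sq, sq, e1, e2, one_mul]
  · intro F _ hF
    by_cases h1 : u ∈ F.1
    · by_cases h2 : w ∈ F.1
      · exfalso
        apply hF
        apply Subtype.ext
        refine (Finset.eq_of_subset_of_card_le ?_ ?_).symm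
        · simp [mkp, Finset.insert_subset_iff, h1, h2]
        · rw [F.2, (mkp u w h).2]
      · rw [dS_not_mem h2, mul_zero]
    · rw [dS_not_mem h1, zero_mul]
  · simp

theorem KS_zero {S : Finset (Fin n)} {u w : Fin n} (h : u ∉ S) : KS S u w = 0 :=
  Finset.sum_eq_zero fun F _ => by rw [dS_not_mem_S h, zero_mul]

theorem KS_zero' {S : Finset (Fin n)} {u w : Fin n} (h : w ∉ S) : KS S u w = 0 :=
  Finset.sum_eq_zero fun F _ => by rw [dS_not_mem_S h, mul_zero]

theorem KS_trace (S : Finset (Fin n)) : ∑ u, KS S u u = S.card * ((S.card : ℝ) - 1) := by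
  rw [← Finset.sum_subset (Finset.subset_univ S) fun u _ hu => KS_zero hu,
    Finset.sum_congr rfl fun u hu => KS_diag hu, Finset.sum_const, nsmul_eq_mul]

theorem KS_total (S : Finset (Fin n)) :
    ∑ u, ∑ w, KS S u w ^ 2 = S.card * (S.card * ((S.card : ℝ) - 1)) := by
  have h : ∀ u ∈ S, ∑ w, KS S u w ^ 2 = S.card * ((S.card : ℝ) - 1) := by
    intro u hu
    rw [← Finset.sum_subset (Finset.subset_univ S) fun w _ hw => by rw [KS_zero' hw]; simp]
    have : ∀ w ∈ S, KS S u w ^ 2 = 1 + if w = u then (((S.card : ℝ) - 1) ^ 2 - 1) else 0 := by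
      intro w hw
      split_ifs with h
      · rw [h, KS_diag hu]; ring
      · rw [KS_off hu hw (Ne.symm h), add_zero]
    rw [Finset.sum_congr rfl this, Finset.sum_add_distrib, Finset.sum_ite_eq' S u, if_pos hu]
    simp
    ring
  rw [← Finset.sum_subset (Finset.subset_univ S) fun u _ hu =>
    Finset.sum_eq_zero fun w _ => by rw [KS_zero hu]; simp]
  rw [Finset.sum_congr rfl h, Finset.sum_const, nsmul_eq_mul]

/-- the (unnormalized) feasible matrix attached to `S` -/
def YS (S : Finset (Fin n)) : Matrix (KSet (Fin n) 2) (KSet (Fin n) 2) ℝ :=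
  fun F F' => ∑ u, dS S u F * dS S u F'

theorem YS_psd (S : Finset (Fin n)) : (YS S).PosSemidef := by
  have h := Matrix.posSemidef_conjTranspose_mul_self (Matrix.of (dS S))
  have e : YS S = (Matrix.of (dS S))ᴴ * Matrix.of (dS S) := by
    ext F F'
    simp [YS, Matrix.mul_apply]
  rw [e]
  exact h

theorem YS_apply (S : Finset (Fin n)) (F F' : KSet (Fin n) 2) :
    YS S F F' = if F.1 ⊆ S ∧ F'.1 ⊆ S then Lc (Fin n) 2 F F' else 0 := by
  unfold YS dS
  rw [Lc_eq]
  by_cases h : F.1 ⊆ S <;> by_cases h' : F'.1 ⊆ S <;> simp [h, h']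

theorem YS_trace (S : Finset (Fin n)) : Matrix.trace (YS S) = S.card * ((S.card : ℝ) - 1) := by
  rw [← KS_trace]
  simp only [Matrix.trace, Matrix.diag, YS, KS]
  exact Finset.sum_comm

theorem YS_obj (S : Finset (Fin n)) :
    Matrix.trace (Lc (Fin n) 2 * YS S) = S.card * (S.card * ((S.card : ℝ) - 1)) := by
  rw [← KS_total]
  have h1 : ∀ F F', Lc (Fin n) 2 F F' * YS S F' F = YS S F F' * YS S F' F := by
    intro F F'
    rw [YS_apply, YS_apply]
    by_cases h : F.1 ⊆ S <;> by_cases h' : F'.1 ⊆ S <;> simp [h, h']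
  simp only [Matrix.trace, Matrix.diag, Matrix.mul_apply, h1]
  simp only [YS, KS, sq, Finset.sum_mul_sum]
  have e1 : ∑ F : KSet (Fin n) 2, ∑ F' : KSet (Fin n) 2, ∑ u : Fin n, ∑ w : Fin n,
      dS S u F * dS S u F' * (dS S w F' * dS S w F)
      = ∑ F : KSet (Fin n) 2, ∑ u : Fin n, ∑ w : Fin n, ∑ F' : KSet (Fin n) 2,
      dS S u F * dS S u F' * (dS S w F' * dS S w F) := by
    refine Finset.sum_congr rfl fun F _ => ?_
    rw [Finset.sum_comm]
    exact Finset.sum_congr rfl fun u _ => Finset.sum_comm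
  rw [e1, Finset.sum_comm]
  refine Finset.sum_congr rfl fun u _ => ?_
  rw [Finset.sum_comm]
  refine Finset.sum_congr rfl fun w _ => Finset.sum_congr rfl fun F _ =>
    Finset.sum_congr rfl fun F' _ => ?_
  ring

theorem eps_mul_Lc (F F' : KSet (Fin n) 2) : eps F.1 F'.1 * Lc (Fin n) 2 F F'
    = if (F.1 ∪ F'.1).card = 3 then 1 else 0 := by
  have hc := Finset.card_union_add_card_inter F.1 F'.1
  rw [F.2, F'.2] at hc
  split_ifs with h
  · obtain ⟨p, hp⟩ := Finset.card_eq_one.mp (show (F.1 ∩ F'.1).card = 1 by omega)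
    have hne : F ≠ F' := by
      rintro rfl
      rw [Finset.union_self, F.2] at h
      omega
    have hpm : p ∈ F.1 ∩ F'.1 := by rw [hp]; simp
    unfold Lc
    rw [if_neg hne, eps_inter hp]
    have e1 := inc_sq F.2 (Finset.mem_inter.mp hpm).1
    have e2 := inc_sq F'.2 (Finset.mem_inter.mp hpm).2
    rw [mul_mul_mul_comm, e1, e2, one_mul]
  · rw [eps_zero F.2 (by omega), zero_mul]

theorem YS_feasible (X : SC (Fin n)) (S : Finset (Fin n)) (hS : X.IsIndep 2 S) (h2 : 2 ≤ S.card) :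
    thetaFeasible X 2 ((S.card * ((S.card : ℝ) - 1))⁻¹ • YS S) := by
  have hc : (2 : ℝ) ≤ S.card := by exact_mod_cast h2
  have hpos : 0 < S.card * ((S.card : ℝ) - 1) := by nlinarith
  refine ⟨(YS_psd S).smul (inv_nonneg.mpr hpos.le), ?_, ?_, ?_, ?_⟩
  · rw [Matrix.trace_smul, YS_trace, smul_eq_mul, inv_mul_cancel₀ hpos.ne']
  · intro F F' h
    rw [Matrix.smul_apply, YS_apply, if_neg, smul_zero]
    rintro ⟨ha, hb⟩
    exact hS _ h (Finset.union_subset ha hb)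
  · intro F F' h
    have hc := Finset.card_union_add_card_inter F.1 F'.1
    rw [F.2, F'.2] at hc
    have hne : F ≠ F' := by
      rintro rfl
      rw [Finset.union_self, F.2] at h
      omega
    have : Lc (Fin n) 2 F F' = 0 := by
      unfold Lc
      rw [if_neg hne, eps_zero F.2 (by omega)]
    rw [Matrix.smul_apply, YS_apply, this, ite_self, smul_zero]
  · intro F F' G G' h
    have key : ∀ F F' : KSet (Fin n) 2, eps F.1 F'.1 * ((S.card * ((S.card : ℝ) - 1))⁻¹ • YS S) F F'
        = (S.card * ((S.card : ℝ) - 1))⁻¹ *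
          (if F.1 ∪ F'.1 ⊆ S then (if (F.1 ∪ F'.1).card = 3 then 1 else 0) else 0) := by
      intro F F'
      rw [← eps_mul_Lc, Matrix.smul_apply, YS_apply, smul_eq_mul]
      by_cases hs : F.1 ⊆ S ∧ F'.1 ⊆ S
      · rw [if_pos hs, if_pos (Finset.union_subset hs.1 hs.2)]
        ring
      · rw [if_neg hs, if_neg (fun hh => hs (Finset.union_subset_iff.mp hh))]
        ring
    rw [key, key, h]

end low

/-- the union of the first two parts -/
def S0 (m : ℕ) : Finset (Fin (3 * m)) :=
  (((Finset.univ.erase (2 : Fin 3)) ×ˢ (Finset.univ : Finset (Fin m))).map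
    (finProdFinEquiv (m := 3) (n := m)).toEmbedding)

theorem S0_card (m : ℕ) : (S0 m).card = 2 * m := by
  simp [S0]

theorem S0_indep (m : ℕ) : (tripartite m).IsIndep 2 (S0 m) := by
  intro H hH hHS
  rw [mem_trip] at hH
  have : H.card ≤ (Finset.range 2).card := by
    refine Finset.card_le_card_of_injOn (fun v => v.val / m) ?_ ?_
    · intro v hv
      have h := hHS hv
      simp only [S0, Finset.mem_map, Finset.mem_product, Finset.mem_erase] at h
      obtain ⟨u, ⟨⟨hu, _⟩, _⟩, rfl⟩ := h
      have := fpf_div u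
      simp only [Equiv.coe_toEmbedding, this, Finset.coe_range, Set.mem_Iio]
      have h3 := u.1.2
      have h4 : u.1.val ≠ 2 := fun h => hu (Fin.ext h)
      omega
    · intro v hv w hw h
      by_contra hne
      exact hH.2 v hv w hw hne h
  rw [hH.1, Finset.card_range] at this
  omega

theorem indep_le (m : ℕ) (S : Finset (Fin (3 * m))) (hS : (tripartite m).IsIndep 2 S) :
    S.card ≤ 2 * m := by
  have : ∃ i : Fin 3, ∀ a : Fin m, finProdFinEquiv (i, a) ∉ S := by
    by_contra! h
    choose f hf using h
    refine hS _ (trip_triple (u := finProdFinEquiv (0, f 0)) (v := finProdFinEquiv (1, f 1))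
      (w := finProdFinEquiv (2, f 2)) ?_ ?_ ?_) ?_
    · rw [fpf_div, fpf_div]; simp
    · rw [fpf_div, fpf_div]; simp
    · rw [fpf_div, fpf_div]; simp
    · intro z hz
      simp only [Finset.mem_insert, Finset.mem_singleton] at hz
      rcases hz with rfl | rfl | rfl <;> apply hf
  obtain ⟨i, hi⟩ := this
  have h : S.card ≤ ((Finset.univ.erase i) ×ˢ (Finset.univ : Finset (Fin m))).card := by
    refine Finset.card_le_card_of_injOn (finProdFinEquiv (m := 3) (n := m)).symm ?_
      (Equiv.injective _).injOn
    intro v hv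
    obtain ⟨⟨j, a⟩, rfl⟩ := (finProdFinEquiv (m := 3) (n := m)).surjective v
    have : j ≠ i := by
      rintro rfl
      exact hi a hv
    simp [this]
  simpa using h

/-- For the complete tripartite 2-complex `K²_{m,m,m}`, both the
independence number and the theta number equal `2m`. -/
theorem tripartite_alpha_theta
    (m : ℕ) (hm : 1 ≤ m) :
    alphaNum (tripartite m) 2 = 2 * m ∧ theta (tripartite m) 2 = (2 * m : ℝ) := by
  constructor
  · refine IsGreatest.csSup_eq ⟨⟨S0 m, S0_indep m, S0_card m⟩, ?_⟩
    rintro _ ⟨S, hS, rfl⟩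
    exact indep_le m S hS
  · refine IsGreatest.csSup_eq ⟨⟨_, YS_feasible (tripartite m) (S0 m) (S0_indep m) ?_, ?_⟩, ?_⟩
    · rw [S0_card]; omega
    · have h1 : (1 : ℝ) ≤ m := by exact_mod_cast hm
      rw [Matrix.mul_smul, Matrix.trace_smul, YS_obj, S0_card, smul_eq_mul]
      push_cast
      have h2 : (2 * (m : ℝ) * (2 * m - 1)) ≠ 0 := by
        apply ne_of_gt
        nlinarith
      rw [mul_left_comm, inv_mul_cancel₀ h2, mul_one]
    · rintro _ ⟨Y, hY, rfl⟩
      exact theta_upper hm Y hY
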